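/- arXiv:2509.20505 — 2 statements merged into one kernel-verified Lean document; each statement's English description precedes it below -/
import Mathlib

section
/- For every κ > 0 and every ξ = (ξ₁,ξ₂,ξ₃) ∈ ℝ³, writing r = |ξ_h|, Σ = Σ_κ(ξ), Ω = Ω_κ(ξ): [(κ²Σ² − 1)² + κ²r²]·[(κ²Ω² − 1)² + κ²r²] = κ⁶·d₁(ξ)²·d₂(ξ)²·r² and [(κ²Σ² − 1)² + κ²r²] + [(κ²Ω² − 1)² + κ²r²] = κ⁴·d₁(ξ)²·d₂(ξ)². Moreover, if r > 0 then κ²r²/[(κ²Σ² − 1)² + κ²r²] + κ²r²/[(κ²Ω² − 1)² + κ²r²] = 1 (normalization of the coefficients b_{ρ,1}, b_{ρ,2} of the dispersive change of unknowns). -/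
noncomputable section

/-- `d₁(ξ) = √(ξ₁² + ξ₂² + (ξ₃ − κ⁻¹)²)`, the distance from `ξ` to `(0,0,κ⁻¹)`. -/
def d1 (κ ξ₁ ξ₂ ξ₃ : ℝ) : ℝ := Real.sqrt (ξ₁ ^ 2 + ξ₂ ^ 2 + (ξ₃ - κ⁻¹) ^ 2)

/-- `d₂(ξ) = √(ξ₁² + ξ₂² + (ξ₃ + κ⁻¹)²)`, the distance from `ξ` to `(0,0,−κ⁻¹)`. -/
def d2 (κ ξ₁ ξ₂ ξ₃ : ℝ) : ℝ := Real.sqrt (ξ₁ ^ 2 + ξ₂ ^ 2 + (ξ₃ + κ⁻¹) ^ 2)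

/-- `Σ_κ(ξ) = (d₂(ξ) + d₁(ξ))/2`, the sound wave dispersion relation. -/
def Sig (κ ξ₁ ξ₂ ξ₃ : ℝ) : ℝ := (d2 κ ξ₁ ξ₂ ξ₃ + d1 κ ξ₁ ξ₂ ξ₃) / 2

/-- `Ω_κ(ξ) = (d₂(ξ) − d₁(ξ))/2`, the inertial wave dispersion relation. -/
def Om (κ ξ₁ ξ₂ ξ₃ : ℝ) : ℝ := (d2 κ ξ₁ ξ₂ ξ₃ - d1 κ ξ₁ ξ₂ ξ₃) / 2

/-- The Euclidean norm `|ξ|` of `ξ ∈ ℝ³`. -/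
def nrm3 (ξ₁ ξ₂ ξ₃ : ℝ) : ℝ := Real.sqrt (ξ₁ ^ 2 + ξ₂ ^ 2 + ξ₃ ^ 2)

/-- The horizontal norm `|ξ_h| = √(ξ₁² + ξ₂²)`. -/
def nrmh (ξ₁ ξ₂ : ℝ) : ℝ := Real.sqrt (ξ₁ ^ 2 + ξ₂ ^ 2)

theorem sq_add_mul_sq_add_of_mul_eq_neg {p q c : ℝ} (h : p * q = -c) :
    (p ^ 2 + c) * (q ^ 2 + c) = c * (p - q) ^ 2 := by
  obtain rfl : c = -(p * q) := by linarith
  ring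

theorem sq_add_add_sq_add_of_mul_eq_neg {p q c : ℝ} (h : p * q = -c) :
    (p ^ 2 + c) + (q ^ 2 + c) = (p - q) ^ 2 := by
  obtain rfl : c = -(p * q) := by linarith
  ring

theorem div_sq_add_add_div_sq_add_of_mul_eq_neg {p q c : ℝ} (hc : 0 < c) (h : p * q = -c) :
    c / (p ^ 2 + c) + c / (q ^ 2 + c) = 1 := by
  have hp : p ^ 2 + c ≠ 0 := by positivity
  have hq : q ^ 2 + c ≠ 0 := by positivity
  rw [div_add_div _ _ hp hq, div_eq_one_iff_eq (mul_ne_zero hp hq),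
    sq_add_mul_sq_add_of_mul_eq_neg h, ← sq_add_add_sq_add_of_mul_eq_neg h]
  ring

theorem sq_Sig_sub_sq_Om (κ ξ₁ ξ₂ ξ₃ : ℝ) :
    Sig κ ξ₁ ξ₂ ξ₃ ^ 2 - Om κ ξ₁ ξ₂ ξ₃ ^ 2 = d1 κ ξ₁ ξ₂ ξ₃ * d2 κ ξ₁ ξ₂ ξ₃ := by
  unfold Sig Om
  ring

theorem d1_sq (κ ξ₁ ξ₂ ξ₃ : ℝ) :
    d1 κ ξ₁ ξ₂ ξ₃ ^ 2 = ξ₁ ^ 2 + ξ₂ ^ 2 + (ξ₃ - κ⁻¹) ^ 2 :=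
  Real.sq_sqrt (by positivity)

theorem d2_sq (κ ξ₁ ξ₂ ξ₃ : ℝ) :
    d2 κ ξ₁ ξ₂ ξ₃ ^ 2 = ξ₁ ^ 2 + ξ₂ ^ 2 + (ξ₃ + κ⁻¹) ^ 2 :=
  Real.sq_sqrt (by positivity)

theorem nrmh_sq (ξ₁ ξ₂ : ℝ) : nrmh ξ₁ ξ₂ ^ 2 = ξ₁ ^ 2 + ξ₂ ^ 2 :=
  Real.sq_sqrt (by positivity)

theorem Sig_mul_Om (κ ξ₁ ξ₂ ξ₃ : ℝ) : Sig κ ξ₁ ξ₂ ξ₃ * Om κ ξ₁ ξ₂ ξ₃ = ξ₃ * κ⁻¹ := by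
  unfold Sig Om
  linear_combination (d2_sq κ ξ₁ ξ₂ ξ₃ - d1_sq κ ξ₁ ξ₂ ξ₃) / 4

theorem sq_Sig_add_sq_Om (κ ξ₁ ξ₂ ξ₃ : ℝ) :
    Sig κ ξ₁ ξ₂ ξ₃ ^ 2 + Om κ ξ₁ ξ₂ ξ₃ ^ 2 = ξ₁ ^ 2 + ξ₂ ^ 2 + ξ₃ ^ 2 + κ⁻¹ ^ 2 := by
  unfold Sig Om
  linear_combination (d2_sq κ ξ₁ ξ₂ ξ₃ + d1_sq κ ξ₁ ξ₂ ξ₃) / 2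

theorem sq_Sig_sub_one_mul_sq_Om_sub_one {κ : ℝ} (hκ : κ ≠ 0) (ξ₁ ξ₂ ξ₃ : ℝ) :
    (κ ^ 2 * Sig κ ξ₁ ξ₂ ξ₃ ^ 2 - 1) * (κ ^ 2 * Om κ ξ₁ ξ₂ ξ₃ ^ 2 - 1)
      = -(κ ^ 2 * nrmh ξ₁ ξ₂ ^ 2) := by
  have hprod : κ ^ 2 * (Sig κ ξ₁ ξ₂ ξ₃ * Om κ ξ₁ ξ₂ ξ₃) = κ * ξ₃ := by
    rw [Sig_mul_Om]
    field_simp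
  have hsum : κ ^ 2 * (Sig κ ξ₁ ξ₂ ξ₃ ^ 2 + Om κ ξ₁ ξ₂ ξ₃ ^ 2)
      = κ ^ 2 * (ξ₁ ^ 2 + ξ₂ ^ 2 + ξ₃ ^ 2) + 1 := by
    rw [sq_Sig_add_sq_Om]
    field_simp
  rw [nrmh_sq]
  linear_combination
    (κ ^ 2 * (Sig κ ξ₁ ξ₂ ξ₃ * Om κ ξ₁ ξ₂ ξ₃) + κ * ξ₃) * hprod - hsum

/-- Product and sum identities for `(κ²Λ² − 1)² + κ²r²`, `Λ ∈ {Σ_κ, Ω_κ}`,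
and normalization of the coefficients `b_{ρ,1}, b_{ρ,2}` of the dispersive change of
unknowns. -/
theorem b_rho_normalization (κ ξ₁ ξ₂ ξ₃ : ℝ) (hκ : 0 < κ) :
    ((κ ^ 2 * Sig κ ξ₁ ξ₂ ξ₃ ^ 2 - 1) ^ 2 + κ ^ 2 * nrmh ξ₁ ξ₂ ^ 2)
        * ((κ ^ 2 * Om κ ξ₁ ξ₂ ξ₃ ^ 2 - 1) ^ 2 + κ ^ 2 * nrmh ξ₁ ξ₂ ^ 2)
      = κ ^ 6 * d1 κ ξ₁ ξ₂ ξ₃ ^ 2 * d2 κ ξ₁ ξ₂ ξ₃ ^ 2 * nrmh ξ₁ ξ₂ ^ 2 ∧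
    ((κ ^ 2 * Sig κ ξ₁ ξ₂ ξ₃ ^ 2 - 1) ^ 2 + κ ^ 2 * nrmh ξ₁ ξ₂ ^ 2)
        + ((κ ^ 2 * Om κ ξ₁ ξ₂ ξ₃ ^ 2 - 1) ^ 2 + κ ^ 2 * nrmh ξ₁ ξ₂ ^ 2)
      = κ ^ 4 * d1 κ ξ₁ ξ₂ ξ₃ ^ 2 * d2 κ ξ₁ ξ₂ ξ₃ ^ 2 ∧
    (0 < nrmh ξ₁ ξ₂ →
      κ ^ 2 * nrmh ξ₁ ξ₂ ^ 2 / ((κ ^ 2 * Sig κ ξ₁ ξ₂ ξ₃ ^ 2 - 1) ^ 2 + κ ^ 2 * nrmh ξ₁ ξ₂ ^ 2)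
        + κ ^ 2 * nrmh ξ₁ ξ₂ ^ 2
            / ((κ ^ 2 * Om κ ξ₁ ξ₂ ξ₃ ^ 2 - 1) ^ 2 + κ ^ 2 * nrmh ξ₁ ξ₂ ^ 2) = 1) := by
  have h := sq_Sig_sub_one_mul_sq_Om_sub_one hκ.ne' ξ₁ ξ₂ ξ₃
  have hd : (κ ^ 2 * Sig κ ξ₁ ξ₂ ξ₃ ^ 2 - 1) - (κ ^ 2 * Om κ ξ₁ ξ₂ ξ₃ ^ 2 - 1)
      = κ ^ 2 * (d1 κ ξ₁ ξ₂ ξ₃ * d2 κ ξ₁ ξ₂ ξ₃) := by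
    rw [← sq_Sig_sub_sq_Om]
    ring
  refine ⟨?_, ?_, fun hr => div_sq_add_add_div_sq_add_of_mul_eq_neg (by positivity) h⟩
  · rw [sq_add_mul_sq_add_of_mul_eq_neg h, hd]
    ring
  · rw [sq_add_add_sq_add_of_mul_eq_neg h, hd]
    ring
end
end

section
/- For every κ > 0 and every ξ = (ξ₁,ξ₂,ξ₃) ∈ ℝ³, writing r = |ξ_h|, Σ = Σ_κ(ξ), Ω = Ω_κ(ξ): (Ω − κξ₃Σ)² + κ²r²Σ² = κ⁻²·[(κ²Σ² − 1)² + κ²r²] and (Σ − κξ₃Ω)² + κ²r²Ω² = κ⁻²·[(κ²Ω² − 1)² + κ²r²]. -/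
noncomputable section

theorem Om_mul_Sig {κ : ℝ} (hκ : κ ≠ 0) (ξ₁ ξ₂ ξ₃ : ℝ) :
    κ * (Om κ ξ₁ ξ₂ ξ₃ * Sig κ ξ₁ ξ₂ ξ₃) = ξ₃ := by
  have h1 : d1 κ ξ₁ ξ₂ ξ₃ ^ 2 = ξ₁ ^ 2 + ξ₂ ^ 2 + (ξ₃ - κ⁻¹) ^ 2 := Real.sq_sqrt (by positivity)
  have h2 : d2 κ ξ₁ ξ₂ ξ₃ ^ 2 = ξ₁ ^ 2 + ξ₂ ^ 2 + (ξ₃ + κ⁻¹) ^ 2 := Real.sq_sqrt (by positivity)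
  unfold Om Sig
  linear_combination κ / 4 * (h2 - h1) + ξ₃ * mul_inv_cancel₀ hκ

theorem Sig_sq_add_Om_sq (κ ξ₁ ξ₂ ξ₃ : ℝ) :
    Sig κ ξ₁ ξ₂ ξ₃ ^ 2 + Om κ ξ₁ ξ₂ ξ₃ ^ 2 = nrmh ξ₁ ξ₂ ^ 2 + ξ₃ ^ 2 + κ⁻¹ ^ 2 := by
  have h1 : d1 κ ξ₁ ξ₂ ξ₃ ^ 2 = ξ₁ ^ 2 + ξ₂ ^ 2 + (ξ₃ - κ⁻¹) ^ 2 := Real.sq_sqrt (by positivity)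
  have h2 : d2 κ ξ₁ ξ₂ ξ₃ ^ 2 = ξ₁ ^ 2 + ξ₂ ^ 2 + (ξ₃ + κ⁻¹) ^ 2 := Real.sq_sqrt (by positivity)
  have hr : nrmh ξ₁ ξ₂ ^ 2 = ξ₁ ^ 2 + ξ₂ ^ 2 := Real.sq_sqrt (by positivity)
  unfold Om Sig
  linear_combination (h1 + h2) / 2 - hr

/-- The normalization identity for any pair `s`, `o` with the product and sum of squares of the two
dispersion relations; it applies to them in either order. -/
theorem normalization_of_mul_of_sq_add_sq {κ s o r z : ℝ} (hκ : κ ≠ 0) (hmul : κ * (o * s) = z)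
    (hsq : s ^ 2 + o ^ 2 = r ^ 2 + z ^ 2 + κ⁻¹ ^ 2) :
    (o - κ * z * s) ^ 2 + κ ^ 2 * r ^ 2 * s ^ 2
      = κ⁻¹ ^ 2 * ((κ ^ 2 * s ^ 2 - 1) ^ 2 + κ ^ 2 * r ^ 2) := by
  have hr : r ^ 2 = s ^ 2 + o ^ 2 - z ^ 2 - κ⁻¹ ^ 2 := by linear_combination -hsq
  rw [hr, ← hmul]
  field_simp
  ring

/-- Identities giving the normalization of the coefficients
`b_{α,j}, b_{γ,j}` of the dispersive change of unknowns. -/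
theorem b_alpha_gamma_normalization (κ ξ₁ ξ₂ ξ₃ : ℝ) (hκ : 0 < κ) :
    (Om κ ξ₁ ξ₂ ξ₃ - κ * ξ₃ * Sig κ ξ₁ ξ₂ ξ₃) ^ 2
        + κ ^ 2 * nrmh ξ₁ ξ₂ ^ 2 * Sig κ ξ₁ ξ₂ ξ₃ ^ 2
      = κ⁻¹ ^ 2 * ((κ ^ 2 * Sig κ ξ₁ ξ₂ ξ₃ ^ 2 - 1) ^ 2 + κ ^ 2 * nrmh ξ₁ ξ₂ ^ 2) ∧
    (Sig κ ξ₁ ξ₂ ξ₃ - κ * ξ₃ * Om κ ξ₁ ξ₂ ξ₃) ^ 2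
        + κ ^ 2 * nrmh ξ₁ ξ₂ ^ 2 * Om κ ξ₁ ξ₂ ξ₃ ^ 2
      = κ⁻¹ ^ 2 * ((κ ^ 2 * Om κ ξ₁ ξ₂ ξ₃ ^ 2 - 1) ^ 2 + κ ^ 2 * nrmh ξ₁ ξ₂ ^ 2) := by
  have hmul := Om_mul_Sig hκ.ne' ξ₁ ξ₂ ξ₃
  have hsq := Sig_sq_add_Om_sq κ ξ₁ ξ₂ ξ₃
  exact ⟨normalization_of_mul_of_sq_add_sq hκ.ne' hmul hsq,
    normalization_of_mul_of_sq_add_sq hκ.ne' (mul_comm (Om κ ξ₁ ξ₂ ξ₃) _ ▸ hmul)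
      (add_comm (Sig κ ξ₁ ξ₂ ξ₃ ^ 2) _ ▸ hsq)⟩
end
end
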